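/- Let (𝒫, ℒ) be a 3-dimensional generalized projective space. Then its dual (𝒫*, ℒ*), whose points are the planes of (𝒫, ℒ) and whose lines are the pencils of planes, is a linear space, and it is itself a 3-dimensional generalized projective space. -/

import Mathlib

/-- A linear space: a point set `P` together with a set of lines (subsets of `P`),
each line having at least two points, and any two distinct points lying on
exactly one line. -/
structure LinearSpace (P : Type*) where
  lines : Set (Set P)
  two_points : ∀ l ∈ lines, ∃ A B : P, A ≠ B ∧ A ∈ l ∧ B ∈ l
  unique_line : ∀ A B : P, A ≠ B → ∃! l, l ∈ lines ∧ A ∈ l ∧ B ∈ l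

namespace LinearSpace

variable {P : Type*} (LS : LinearSpace P)

/-- A subspace: a subset containing, with any two of its distinct points,
the line joining them. -/
def IsSubspace (S : Set P) : Prop :=
  ∀ l ∈ LS.lines, ∀ A ∈ l, ∀ B ∈ l, A ≠ B → A ∈ S → B ∈ S → l ⊆ S

/-- The span of a subset: the intersection of all subspaces containing it. -/
def span (S : Set P) : Set P :=
  ⋂₀ {T | LS.IsSubspace T ∧ S ⊆ T}

/-- The dimension of a subset `S` (intended for subspaces):
`min {#X - 1 | X ⊆ S, span X = S}` as an extended natural number. -/
noncomputable def sdim (S : Set P) : ℕ∞ :=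
  sInf {d : ℕ∞ | ∃ X : Set P, X ⊆ S ∧ LS.span X = S ∧ d = X.encard - 1}

/-- The dimension of the linear space: `min {#X - 1 | span X = P}`. -/
noncomputable def dim : ℕ∞ := LS.sdim Set.univ

/-- A plane is a 2-dimensional subspace. -/
def IsPlane (E : Set P) : Prop := LS.IsSubspace E ∧ LS.sdim E = 2

/-- A generalized projective space: every plane is a generalized projective
plane, i.e. any two distinct lines contained in a common plane meet. -/
def IsGenProjSpace : Prop :=
  ∀ E : Set P, LS.IsPlane E →
    ∀ l ∈ LS.lines, ∀ m ∈ LS.lines, l ⊆ E → m ⊆ E → l ≠ m → (l ∩ m).Nonempty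

/-- A related set: a set of lines which pairwise meet. -/
def IsRelatedSet (N : Set (Set P)) : Prop :=
  N ⊆ LS.lines ∧ ∀ a ∈ N, ∀ b ∈ N, (a ∩ b).Nonempty

/-- A maximal related set: a related set maximal with respect to inclusion. -/
def IsMaxRelatedSet (M : Set (Set P)) : Prop :=
  LS.IsRelatedSet M ∧ ∀ N, LS.IsRelatedSet N → M ⊆ N → N = M

/-- The star of lines with vertex `A`: all lines through `A`. -/
def star (A : P) : Set (Set P) := {l | l ∈ LS.lines ∧ A ∈ l}

/-- The pencil of planes with axis `a`: all planes containing `a`. -/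
def pencil (a : Set P) : Set (Set P) := {E | LS.IsPlane E ∧ a ⊆ E}

/-- A collineation: a bijection of the point sets mapping each line onto a
line, and whose inverse does likewise. -/
def IsCollineation {P' : Type*} (LS' : LinearSpace P') (κ : P → P') : Prop :=
  Function.Bijective κ ∧ (∀ l ∈ LS.lines, κ '' l ∈ LS'.lines) ∧
    (∀ l' ∈ LS'.lines, κ ⁻¹' l' ∈ LS.lines)

end LinearSpace

namespace LinearSpace

variable {P : Type*} {LS : LinearSpace P}

section Span

lemma isSubspace_span (S : Set P) : LS.IsSubspace (LS.span S) := by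
  intro l hl A hA B hB hAB hAS hBS
  refine Set.subset_sInter fun T hT => ?_
  exact hT.1 l hl A hA B hB hAB (hAS T hT) (hBS T hT)

lemma subset_span (S : Set P) : S ⊆ LS.span S :=
  Set.subset_sInter fun _ hT => hT.2

lemma span_subset {S T : Set P} (hT : LS.IsSubspace T) (h : S ⊆ T) : LS.span S ⊆ T :=
  Set.sInter_subset_of_mem ⟨hT, h⟩

lemma mem_span_insert (A : P) (S : Set P) : A ∈ LS.span (insert A S) :=
  subset_span _ (Set.mem_insert A S)

lemma subset_span_insert (A : P) (S : Set P) : S ⊆ LS.span (insert A S) :=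
  (Set.subset_insert A S).trans (subset_span _)

lemma sdim_le {X S : Set P} (h : LS.span X = S) : LS.sdim S ≤ X.encard - 1 :=
  sInf_le ⟨X, h ▸ subset_span X, h, rfl⟩

lemma exists_span_eq_of_sdim_eq {S : Set P} {n : ℕ} (h : LS.sdim S = n) :
    ∃ X : Set P, LS.span X = S ∧ X.encard - 1 = n := by
  have hne : {d : ℕ∞ | ∃ X : Set P, X ⊆ S ∧ LS.span X = S ∧ d = X.encard - 1}.Nonempty := by
    rw [Set.nonempty_iff_ne_empty]
    intro he
    rw [sdim, he, sInf_empty] at h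
    exact ENat.top_ne_natCast n h
  obtain ⟨X, -, hX, hd⟩ := csInf_mem hne
  exact ⟨X, hX, hd.symm.trans h⟩

end Span

section Lines

lemma exists_line {A B : P} (h : A ≠ B) : ∃ l ∈ LS.lines, A ∈ l ∧ B ∈ l :=
  (LS.unique_line A B h).exists

lemma line_eq {A B : P} (h : A ≠ B) {l m : Set P} (hl : l ∈ LS.lines) (hm : m ∈ LS.lines)
    (hAl : A ∈ l) (hBl : B ∈ l) (hAm : A ∈ m) (hBm : B ∈ m) : l = m :=
  (LS.unique_line A B h).unique ⟨hl, hAl, hBl⟩ ⟨hm, hAm, hBm⟩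

lemma isSubspace_line {l : Set P} (hl : l ∈ LS.lines) : LS.IsSubspace l := by
  intro m hm A hA B hB hAB hAl hBl
  exact (line_eq hAB hm hl hA hB hAl hBl).subset

lemma line_eq_of_subset {l m : Set P} (hl : l ∈ LS.lines) (hm : m ∈ LS.lines) (h : l ⊆ m) :
    l = m := by
  obtain ⟨A, B, hAB, hA, hB⟩ := LS.two_points l hl
  exact line_eq hAB hl hm hA hB (h hA) (h hB)

lemma exists_mem_line_ne {l : Set P} (hl : l ∈ LS.lines) (Q : P) : ∃ B ∈ l, B ≠ Q := by
  obtain ⟨A, B, hAB, hA, hB⟩ := LS.two_points l hl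
  by_cases h : A = Q
  · exact ⟨B, hB, fun h' => hAB (h.trans h'.symm)⟩
  · exact ⟨A, hA, h⟩

end Lines

section Planes

lemma IsPlane.not_subset_line {E l : Set P} (hE : LS.IsPlane E) (hl : l ∈ LS.lines) :
    ¬ E ⊆ l := by
  intro hEl
  obtain ⟨X, hX, hc⟩ := exists_span_eq_of_sdim_eq (n := 2) hE.2
  have hc' : 1 < X.encard := by
    by_contra! hle
    rw [tsub_eq_zero_of_le hle] at hc
    norm_num at hc
  obtain ⟨A, B, hA, hB, hAB⟩ := Set.one_lt_encard_iff.1 hc'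
  have hXE : X ⊆ E := hX ▸ subset_span X
  have hspan : LS.span {A, B} = E := by
    apply (span_subset hE.1 (Set.pair_subset (hXE hA) (hXE hB))).antisymm
    refine hEl.trans ?_
    exact isSubspace_span _ l hl A (hEl (hXE hA)) B (hEl (hXE hB)) hAB
      (subset_span _ (by simp)) (subset_span _ (by simp))
  have hle := sdim_le hspan
  rw [hE.2, Set.encard_pair hAB] at hle
  exact absurd hle (by decide)

lemma exists_line_superset {l X : Set P} (hl : l ∈ LS.lines) (hX : X.encard ≤ 2) :
    ∃ m ∈ LS.lines, X ⊆ m := by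
  by_cases h : X.encard ≤ 1
  · rcases Set.encard_le_one_iff_eq.1 h with rfl | ⟨A, rfl⟩
    · exact ⟨l, hl, Set.empty_subset l⟩
    · obtain ⟨B, -, hB⟩ := exists_mem_line_ne hl A
      obtain ⟨m, hm, -, hA⟩ := exists_line (LS := LS) hB
      exact ⟨m, hm, Set.singleton_subset_iff.2 hA⟩
  · have h2 : X.encard = 2 :=
      hX.antisymm (by simpa [one_add_one_eq_two] using Order.add_one_le_of_lt (not_le.1 h))
    obtain ⟨A, B, hAB, rfl⟩ := Set.encard_eq_two.1 h2
    obtain ⟨m, hm, hA, hB⟩ := exists_line (LS := LS) hAB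
    exact ⟨m, hm, Set.pair_subset hA hB⟩

lemma isPlane_span_insert {l : Set P} (hl : l ∈ LS.lines) {A : P} (hA : A ∉ l) :
    LS.IsPlane (LS.span (insert A l)) := by
  refine ⟨isSubspace_span _, le_antisymm ?_ ?_⟩
  · obtain ⟨B, C, hBC, hB, hC⟩ := LS.two_points l hl
    have hspan : LS.span {A, B, C} = LS.span (insert A l) := by
      apply (span_subset (isSubspace_span _) _).antisymm (span_subset (isSubspace_span _) _)
      · refine Set.Subset.trans ?_ (subset_span _)
        exact Set.insert_subset_insert (Set.pair_subset hB hC)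
      · refine Set.insert_subset (mem_span_insert _ _) ?_
        exact isSubspace_span _ l hl B hB C hC hBC
          (subset_span _ (by simp)) (subset_span _ (by simp))
    refine (sdim_le hspan).trans ?_
    rw [Set.encard_eq_three.2 ⟨A, B, C, fun h => hA (h ▸ hB), fun h => hA (h ▸ hC), hBC, rfl⟩]
    decide
  · refine le_sInf ?_
    rintro d ⟨X, -, hX, rfl⟩
    by_contra! hlt
    have hX2 : X.encard ≤ 2 := by
      have h := Order.le_of_lt_add_one (x := X.encard - 1) (y := 1) hlt
      exact (tsub_le_iff_right.1 h).trans_eq rfl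
    obtain ⟨m, hm, hXm⟩ := exists_line_superset hl hX2
    have hsub : LS.span (insert A l) ⊆ m := hX ▸ span_subset (isSubspace_line hm) hXm
    have hlm := line_eq_of_subset hl hm ((subset_span_insert A l).trans hsub)
    exact hA (hlm ▸ hsub (mem_span_insert A l))

lemma IsPlane.nonempty {E : Set P} (hE : LS.IsPlane E) : E.Nonempty := by
  obtain ⟨X, rfl, hc⟩ := exists_span_eq_of_sdim_eq (n := 2) hE.2
  refine Set.Nonempty.mono (subset_span X) (Set.nonempty_iff_ne_empty.2 ?_)
  rintro rfl
  norm_num at hc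

lemma IsPlane.exists_line_notMem {E : Set P} (hE : LS.IsPlane E) (Q : P) :
    ∃ l ∈ LS.lines, l ⊆ E ∧ Q ∉ l := by
  have key : ∀ m ∈ LS.lines, m ⊆ E → ∃ l ∈ LS.lines, l ⊆ E ∧ Q ∉ l := by
    intro m hm hmE
    obtain ⟨A, hAE, hA⟩ := Set.not_subset.1 (hE.not_subset_line hm)
    obtain ⟨B, hB, hBQ⟩ := exists_mem_line_ne hm Q
    by_cases hQ : Q ∈ m
    · have hAB : A ≠ B := fun h => hA (h ▸ hB)
      obtain ⟨l, hl, hAl, hBl⟩ := exists_line (LS := LS) hAB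
      refine ⟨l, hl, hE.1 l hl A hAl B hBl hAB hAE (hmE hB), fun hQl => hA ?_⟩
      exact line_eq hBQ hl hm hBl hQl hB hQ ▸ hAl
    · exact ⟨m, hm, hmE, hQ⟩
  by_cases hne : ∃ A ∈ E, ∃ B ∈ E, A ≠ B
  · obtain ⟨A, hA, B, hB, hAB⟩ := hne
    obtain ⟨m, hm, hAm, hBm⟩ := exists_line (LS := LS) hAB
    exact key m hm (hE.1 m hm A hAm B hBm hAB hA hB)
  · exfalso
    push Not at hne
    have hle : E.encard ≤ 1 := Set.encard_le_one_iff.2 fun A B hA hB => hne A hA B hB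
    have hd := sdim_le (LS := LS) ((span_subset hE.1 subset_rfl).antisymm (subset_span E))
    rw [hE.2, tsub_eq_zero_of_le hle] at hd
    exact absurd hd (by decide)

lemma exists_plane_of_meet {a b : Set P} (ha : a ∈ LS.lines) (hb : b ∈ LS.lines) (hab : a ≠ b)
    {Q : P} (hQa : Q ∈ a) (hQb : Q ∈ b) : ∃ E, LS.IsPlane E ∧ a ⊆ E ∧ b ⊆ E := by
  obtain ⟨B, hB, hBQ⟩ := exists_mem_line_ne hb Q
  have hBa : B ∉ a := fun h => hab (line_eq hBQ ha hb h hQa hB hQb)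
  exact ⟨_, isPlane_span_insert ha hBa, subset_span_insert B a,
    isSubspace_span _ b hb B hB Q hQb hBQ (mem_span_insert B a) (subset_span_insert B a hQa)⟩

end Planes

section GenProjSpace

lemma IsGenProjSpace.plane_subset (hG : LS.IsGenProjSpace) {E T l : Set P} (hE : LS.IsPlane E)
    (hT : LS.IsSubspace T) (hl : l ∈ LS.lines) (hlE : l ⊆ E) (hlT : l ⊆ T) {A : P}
    (hAE : A ∈ E) (hAT : A ∈ T) (hA : A ∉ l) : E ⊆ T := by
  intro Q hQ
  by_cases hAQ : A = Q
  · rwa [← hAQ]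
  obtain ⟨m, hm, hAm, hQm⟩ := exists_line (LS := LS) hAQ
  obtain ⟨R, hRm, hRl⟩ := hG E hE m hm l hl (hE.1 m hm A hAm Q hQm hAQ hAE hQ) hlE
    fun h => hA (h ▸ hAm)
  exact hT m hm A hAm R hRm (fun h => hA (h ▸ hRl)) hAT (hlT hRl) hQm

lemma IsGenProjSpace.plane_eq (hG : LS.IsGenProjSpace) {E F l : Set P} (hE : LS.IsPlane E)
    (hF : LS.IsPlane F) (hl : l ∈ LS.lines) (hlE : l ⊆ E) (hlF : l ⊆ F) {A : P}
    (hAE : A ∈ E) (hAF : A ∈ F) (hA : A ∉ l) : E = F :=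
  (hG.plane_subset hE hF.1 hl hlE hlF hAE hAF hA).antisymm
    (hG.plane_subset hF hE.1 hl hlF hlE hAF hAE hA)

lemma IsGenProjSpace.mem_of_mem_inter (hG : LS.IsGenProjSpace) {E F l : Set P}
    (hE : LS.IsPlane E) (hF : LS.IsPlane F) (hEF : E ≠ F) (hl : l ∈ LS.lines) (hlE : l ⊆ E)
    (hlF : l ⊆ F) {A : P} (hAE : A ∈ E) (hAF : A ∈ F) : A ∈ l := by
  by_contra hA
  exact hEF (hG.plane_eq hE hF hl hlE hlF hAE hAF hA)

lemma IsGenProjSpace.eq_of_subset (hG : LS.IsGenProjSpace) {E F : Set P}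
    (hE : LS.IsPlane E) (hF : LS.IsPlane F) (h : F ⊆ E) : F = E := by
  obtain ⟨Q, hQ⟩ := hF.nonempty
  obtain ⟨l, hl, hlF, hQl⟩ := hF.exists_line_notMem Q
  exact hG.plane_eq hF hE hl hlF (hlF.trans h) hQ (h hQ) hQl

/-- If two lines through `D` meet the plane `E`, then so does every line of the plane which they
span. -/
lemma IsGenProjSpace.meets_of_triangle (hG : LS.IsGenProjSpace) {E m p q n : Set P}
    (hE : LS.IsPlane E) {D X Y X' Y' : P} (hDE : D ∉ E) (hm : m ∈ LS.lines) (hDm : D ∉ m)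
    (hXm : X ∈ m) (hYm : Y ∈ m) (hXY : X ≠ Y) (hp : p ∈ LS.lines) (hDp : D ∈ p) (hXp : X ∈ p)
    (hX'p : X' ∈ p) (hX'E : X' ∈ E) (hq : q ∈ LS.lines) (hDq : D ∈ q) (hYq : Y ∈ q)
    (hY'q : Y' ∈ q) (hY'E : Y' ∈ E) (hn : n ∈ LS.lines) (hnG : n ⊆ LS.span (insert D m)) :
    (n ∩ E).Nonempty := by
  have hplane := isPlane_span_insert hm hDm
  have hD := mem_span_insert (LS := LS) D m
  have hmG := subset_span_insert (LS := LS) D m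
  have hpG := hplane.1 p hp D hDp X hXp (fun h => hDm (h ▸ hXm)) hD (hmG hXm)
  have hqG := hplane.1 q hq D hDq Y hYq (fun h => hDm (h ▸ hYm)) hD (hmG hYm)
  have hX'Y' : X' ≠ Y' := by
    rintro rfl
    have hpq : p = q := line_eq (fun h : D = X' => hDE (h ▸ hX'E)) hp hq hDp hX'p hDq hY'q
    exact hDm (line_eq hXY hp hm hXp (hpq ▸ hYq) hXm hYm ▸ hDp)
  obtain ⟨k, hk, hX'k, hY'k⟩ := exists_line (LS := LS) hX'Y'
  have hkE := hE.1 k hk X' hX'k Y' hY'k hX'Y' hX'E hY'E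
  have hkG := hplane.1 k hk X' hX'k Y' hY'k hX'Y' (hpG hX'p) (hqG hY'q)
  by_cases hnk : n = k
  · exact ⟨X', hnk ▸ hX'k, hX'E⟩
  · exact (hG _ hplane n hn k hk hnG hkG hnk).mono (Set.inter_subset_inter_right n hkE)

/-- If the plane `E` and the point `D` generate the space, then all lines through `D` meet `E`. -/
lemma IsGenProjSpace.meets_of_mem (hG : LS.IsGenProjSpace) {E : Set P} (hE : LS.IsPlane E)
    {D : P} (hDE : D ∉ E) (hspan : LS.span (insert D E) = Set.univ) {l : Set P}
    (hl : l ∈ LS.lines) (hDl : D ∈ l) : (l ∩ E).Nonempty := by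
  let U : Set P := {Z | ∀ l ∈ LS.lines, D ∈ l → Z ∈ l → (l ∩ E).Nonempty ∨ Z = D}
  have hU : LS.IsSubspace U := by
    intro m hm X hX Y hY hXY hXU hYU Z hZ n hn hDn hZn
    by_cases hDm : D ∈ m
    · by_cases hZD : Z = D
      · exact Or.inr hZD
      left
      have hnm := line_eq hZD hn hm hZn hDn hZ hDm
      subst hnm
      rcases hXU n hn hDn hX with h | h
      · exact h
      rcases hYU n hn hDn hY with h' | h'
      · exact h'
      exact (hXY (h.trans h'.symm)).elim
    · have hXD : X ≠ D := fun h => hDm (h ▸ hX)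
      have hYD : Y ≠ D := fun h => hDm (h ▸ hY)
      obtain ⟨p, hp, hXp, hDp⟩ := exists_line (LS := LS) hXD
      obtain ⟨q, hq, hYq, hDq⟩ := exists_line (LS := LS) hYD
      obtain ⟨X', hX'p, hX'E⟩ := (hXU p hp hDp hXp).resolve_right hXD
      obtain ⟨Y', hY'q, hY'E⟩ := (hYU q hq hDq hYq).resolve_right hYD
      refine Or.inl (hG.meets_of_triangle hE hDE hm hDm hX hY hXY hp hDp hXp hX'p hX'E
        hq hDq hYq hY'q hY'E hn ?_)
      exact isSubspace_span _ n hn D hDn Z hZn (fun h => hDm (h ▸ hZ)) (mem_span_insert D m)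
        (subset_span_insert D m hZ)
  have hsub : LS.span (insert D E) ⊆ U := by
    refine span_subset hU (Set.insert_subset ?_ ?_)
    · exact fun _ _ _ _ => Or.inr rfl
    · exact fun Z hZ n _ _ hZn => Or.inl ⟨Z, hZn, hZ⟩
  obtain ⟨Z, hZ, hZD⟩ := exists_mem_line_ne hl D
  exact (hsub (hspan ▸ Set.mem_univ Z) l hl hDl hZ).resolve_right hZD

lemma IsGenProjSpace.meets_of_span (hG : LS.IsGenProjSpace) {E : Set P} (hE : LS.IsPlane E)
    {D : P} (hDE : D ∉ E) (hspan : LS.span (insert D E) = Set.univ) {l : Set P}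
    (hl : l ∈ LS.lines) : (l ∩ E).Nonempty := by
  by_cases hDl : D ∈ l
  · exact hG.meets_of_mem hE hDE hspan hl hDl
  obtain ⟨X, Y, hXY, hX, hY⟩ := LS.two_points l hl
  obtain ⟨p, hp, hXp, hDp⟩ := exists_line (LS := LS) fun h : X = D => hDl (h ▸ hX)
  obtain ⟨q, hq, hYq, hDq⟩ := exists_line (LS := LS) fun h : Y = D => hDl (h ▸ hY)
  obtain ⟨X', hX'p, hX'E⟩ := hG.meets_of_mem hE hDE hspan hp hDp
  obtain ⟨Y', hY'q, hY'E⟩ := hG.meets_of_mem hE hDE hspan hq hDq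
  exact hG.meets_of_triangle hE hDE hl hDl hX hY hXY hp hDp hXp hX'p hX'E
    hq hDq hYq hY'q hY'E hl (subset_span_insert D l)

lemma exists_line_of_meets {E F : Set P} (hE : LS.IsSubspace E) (hF : LS.IsPlane F)
    (hmeet : ∀ l ∈ LS.lines, (l ∩ E).Nonempty) : ∃ l ∈ LS.lines, l ⊆ E ∧ l ⊆ F := by
  obtain ⟨m, hm, hmF, -⟩ := hF.exists_line_notMem hF.nonempty.some
  obtain ⟨Q, hQm, hQE⟩ := hmeet m hm
  obtain ⟨n, hn, hnF, hQn⟩ := hF.exists_line_notMem Q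
  obtain ⟨R, hRn, hRE⟩ := hmeet n hn
  have hQR : Q ≠ R := fun h => hQn (h ▸ hRn)
  obtain ⟨l, hl, hQl, hRl⟩ := exists_line (LS := LS) hQR
  exact ⟨l, hl, hE l hl Q hQl R hRl hQR hQE hRE,
    hF.1 l hl Q hQl R hRl hQR (hmF hQm) (hnF hRn)⟩

end GenProjSpace

section DimThree

lemma exists_notMem_plane (hdim : LS.dim = 3) {E : Set P} (hE : LS.IsPlane E) : ∃ A, A ∉ E := by
  by_contra! h
  have h2 := hE.2
  rw [Set.eq_univ_of_forall h] at h2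
  exact absurd (hdim.symm.trans h2) (by decide)

lemma exists_tetrahedron (hdim : LS.dim = 3) :
    ∃ l ∈ LS.lines, ∃ C D : P, C ∉ l ∧ D ∉ LS.span (insert C l) ∧
      LS.span (insert D (LS.span (insert C l))) = Set.univ := by
  obtain ⟨X, hX, hc⟩ := exists_span_eq_of_sdim_eq (n := 3) hdim
  have hcard : X.encard = 4 := by
    have h1 : 1 ≤ X.encard := by
      by_contra! hlt
      rw [tsub_eq_zero_of_le hlt.le] at hc
      norm_num at hc
    rw [← tsub_add_cancel_of_le h1, hc]
    rfl
  obtain ⟨A, B, C, D, hAB, hAC, hAD, hBC, hBD, hCD, rfl⟩ := Set.encard_eq_four.1 hcard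
  obtain ⟨l, hl, hA, hB⟩ := exists_line (LS := LS) hAB
  have hCl : C ∉ l := by
    intro hC
    have hspan : LS.span {A, B, D} = Set.univ := by
      rw [← Set.univ_subset_iff, ← hX]
      have hlS : l ⊆ LS.span {A, B, D} := isSubspace_span _ l hl A hA B hB hAB
        (subset_span _ (by simp)) (subset_span _ (by simp))
      refine span_subset (isSubspace_span _) ?_
      rintro Z (rfl | rfl | rfl | rfl)
      exacts [hlS hA, hlS hB, hlS hC, subset_span _ (by simp)]
    have hle := sdim_le hspan
    rw [Set.encard_eq_three.2 ⟨A, B, D, hAB, hAD, hBD, rfl⟩] at hle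
    exact absurd (hdim.symm.trans_le hle) (by decide)
  have hspan : LS.span (insert D (LS.span (insert C l))) = Set.univ := by
    rw [← Set.univ_subset_iff, ← hX]
    have hS := (subset_span (LS := LS) (insert C l)).trans (subset_span_insert (LS := LS) D _)
    refine span_subset (isSubspace_span _) ?_
    rintro Z (rfl | rfl | rfl | rfl)
    exacts [hS (Or.inr hA), hS (Or.inr hB), hS (Or.inl rfl), mem_span_insert _ _]
  refine ⟨l, hl, C, D, hCl, fun hD => ?_, hspan⟩
  rw [Set.insert_eq_of_mem hD] at hspan
  have hplane := isPlane_span_insert hl hCl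
  obtain ⟨Z, hZ⟩ := exists_notMem_plane hdim hplane
  exact hZ (span_subset hplane.1 subset_rfl (hspan ▸ Set.mem_univ Z))

/-- In a 3-dimensional generalized projective space every line meets every plane. -/
lemma IsGenProjSpace.meets (hG : LS.IsGenProjSpace) (hdim : LS.dim = 3) {F l : Set P}
    (hF : LS.IsPlane F) (hl : l ∈ LS.lines) : (l ∩ F).Nonempty := by
  obtain ⟨l₀, hl₀, C, D, hC, hD, hspan⟩ := exists_tetrahedron hdim
  have hE := isPlane_span_insert hl₀ hC
  generalize LS.span (insert C l₀) = E at hE hD hspan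
  by_cases hEF : F = E
  · subst hEF
    exact hG.meets_of_span hE hD hspan hl
  obtain ⟨g, hg, hgE, hgF⟩ :=
    exists_line_of_meets hE.1 hF fun l hl => hG.meets_of_span hE hD hspan hl
  obtain ⟨A, hAF, hAE⟩ := Set.not_subset.1 fun h => hEF (hG.eq_of_subset hE hF h)
  obtain ⟨B, hBE, hBg⟩ := Set.not_subset.1 (hE.not_subset_line hg)
  have hBF : B ∉ F := fun h => hBg (hG.mem_of_mem_inter hE hF (Ne.symm hEF) hg hgE hgF hBE h)
  refine hG.meets_of_span hF hBF ?_ hl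
  have hFS := subset_span_insert (LS := LS) B F
  have hES : E ⊆ LS.span (insert B F) := hG.plane_subset hE (isSubspace_span _) hg hgE
    (hgF.trans hFS) hBE (mem_span_insert B F) hBg
  rw [← Set.univ_subset_iff, ← hspan]
  refine span_subset (isSubspace_span _) (Set.insert_subset ?_ hES)
  by_cases hDA : D = A
  · exact hDA ▸ hFS hAF
  obtain ⟨m, hm, hDm, hAm⟩ := exists_line (LS := LS) hDA
  obtain ⟨Q, hQm, hQE⟩ := hG.meets_of_span hE hD hspan hm
  exact isSubspace_span _ m hm A hAm Q hQm (fun h => hAE (h ▸ hQE)) (hFS hAF) (hES hQE) hDm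

lemma IsGenProjSpace.exists_line_inter (hG : LS.IsGenProjSpace) (hdim : LS.dim = 3)
    {E F : Set P} (hE : LS.IsPlane E) (hF : LS.IsPlane F) :
    ∃ l ∈ LS.lines, l ⊆ E ∧ l ⊆ F :=
  exists_line_of_meets hE.1 hF fun _ hl => hG.meets hdim hE hl

lemma IsGenProjSpace.exists_mem_three_planes (hG : LS.IsGenProjSpace) (hdim : LS.dim = 3)
    {E F G : Set P} (hE : LS.IsPlane E) (hF : LS.IsPlane F) (hG' : LS.IsPlane G) :
    ∃ Q, Q ∈ E ∧ Q ∈ F ∧ Q ∈ G := by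
  obtain ⟨l, hl, hlE, hlF⟩ := hG.exists_line_inter hdim hE hF
  obtain ⟨Q, hQl, hQG⟩ := hG.meets hdim hG' hl
  exact ⟨Q, hlE hQl, hlF hQl, hQG⟩

lemma exists_notMem_line (hdim : LS.dim = 3) {l : Set P} (hl : l ∈ LS.lines) : ∃ A, A ∉ l := by
  obtain ⟨m, hm, C, -, hC, -⟩ := exists_tetrahedron hdim
  by_contra! h
  exact (isPlane_span_insert hm hC).not_subset_line hl fun A _ => h A

lemma exists_two_planes (hdim : LS.dim = 3) {l : Set P} (hl : l ∈ LS.lines) :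
    ∃ E F, LS.IsPlane E ∧ LS.IsPlane F ∧ E ≠ F ∧ l ⊆ E ∧ l ⊆ F := by
  obtain ⟨A, hA⟩ := exists_notMem_line hdim hl
  obtain ⟨B, hB⟩ := exists_notMem_plane hdim (isPlane_span_insert hl hA)
  refine ⟨_, _, isPlane_span_insert hl hA,
    isPlane_span_insert hl fun h => hB (subset_span_insert A l h), fun h => ?_,
    subset_span_insert A l, subset_span_insert B l⟩
  exact hB (h ▸ mem_span_insert B l)

lemma IsGenProjSpace.exists_plane_notMem (hG : LS.IsGenProjSpace) (hdim : LS.dim = 3) (Q : P) :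
    ∃ E, LS.IsPlane E ∧ Q ∉ E := by
  obtain ⟨m, hm, C, -, hC, -⟩ := exists_tetrahedron hdim
  obtain ⟨l, hl, -, hQ⟩ := (isPlane_span_insert hm hC).exists_line_notMem Q
  have hE := isPlane_span_insert hl hQ
  obtain ⟨A, hA⟩ := exists_notMem_plane hdim hE
  have hAl : A ∉ l := fun h => hA (subset_span_insert Q l h)
  refine ⟨_, isPlane_span_insert hl hAl, fun hQA => hA ?_⟩
  exact hG.plane_eq hE (isPlane_span_insert hl hAl) hl (subset_span_insert Q l)
    (subset_span_insert A l) (mem_span_insert Q l) hQA hQ ▸ mem_span_insert A l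

end DimThree

section Dual

/-- The pencil of planes with axis `a`, as a set of points of the dual space. -/
def dualPencil (LS : LinearSpace P) (a : Set P) : Set {E : Set P // LS.IsPlane E} :=
  {E | a ⊆ E.1}

/-- The dual of a 3-dimensional generalized projective space. -/
def dual (LS : LinearSpace P) (hdim : LS.dim = 3) (hG : LS.IsGenProjSpace) :
    LinearSpace {E : Set P // LS.IsPlane E} where
  lines := {S | ∃ a ∈ LS.lines, S = LS.dualPencil a}
  two_points := by
    rintro _ ⟨a, ha, rfl⟩
    obtain ⟨E, F, hE, hF, hEF, haE, haF⟩ := exists_two_planes hdim ha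
    exact ⟨⟨E, hE⟩, ⟨F, hF⟩, fun h => hEF (congrArg Subtype.val h), haE, haF⟩
  unique_line := by
    rintro ⟨E, hE⟩ ⟨F, hF⟩ hEF
    obtain ⟨a, ha, haE, haF⟩ := hG.exists_line_inter hdim hE hF
    refine ⟨LS.dualPencil a, ⟨⟨a, ha, rfl⟩, haE, haF⟩, ?_⟩
    rintro _ ⟨⟨b, hb, rfl⟩, hbE, hbF⟩
    have hba : b ⊆ a := fun A hA =>
      hG.mem_of_mem_inter hE hF (fun h => hEF (Subtype.ext h)) ha haE haF (hbE hA) (hbF hA)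
    rw [line_eq_of_subset hb ha hba]

lemma dualPencil_mem_lines (hdim : LS.dim = 3) (hG : LS.IsGenProjSpace)
    {a : Set P} (ha : a ∈ LS.lines) :
    LS.dualPencil a ∈ (LS.dual hdim hG).lines := ⟨a, ha, rfl⟩

lemma isSubspace_dual_star (hdim : LS.dim = 3) (hG : LS.IsGenProjSpace)
    (Q : P) : (LS.dual hdim hG).IsSubspace {E | Q ∈ E.1} := by
  rintro _ ⟨a, ha, rfl⟩ E haE F haF hEF hQE hQF G haG
  exact haG (hG.mem_of_mem_inter E.2 F.2 (fun h => hEF (Subtype.ext h)) ha haE haF hQE hQF)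

lemma mem_axis_of_forall_mem (hdim : LS.dim = 3) (hG : LS.IsGenProjSpace)
    {a : Set P} (ha : a ∈ LS.lines) {Q : P} (h : ∀ E ∈ LS.dualPencil a, Q ∈ E.1) : Q ∈ a := by
  obtain ⟨E, F, hE, hF, hEF, haE, haF⟩ := exists_two_planes hdim ha
  exact hG.mem_of_mem_inter hE hF hEF ha haE haF (h ⟨E, hE⟩ haE) (h ⟨F, hF⟩ haF)

lemma exists_encard_sdiff_singleton_le {α : Type*} [Nonempty α] {X : Set α} {n : ℕ∞}
    (hX : X.encard ≤ n + 1) : ∃ A, (X \ {A}).encard ≤ n := by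
  rcases X.eq_empty_or_nonempty with rfl | ⟨A, hA⟩
  · exact ⟨Classical.arbitrary α, by simp⟩
  · rw [← Set.encard_sdiff_singleton_add_one hA] at hX
    exact ⟨A, (ENat.add_le_add_iff_right ENat.one_ne_top).1 hX⟩

lemma exists_forall_mem_of_encard_le_three (hdim : LS.dim = 3) (hG : LS.IsGenProjSpace)
    {X : Set {E : Set P // LS.IsPlane E}} (hX : X.encard ≤ 3) : ∃ Q, X ⊆ {E | Q ∈ E.1} := by
  obtain ⟨m, hm, C, -, hC, -⟩ := exists_tetrahedron hdim
  have : Nonempty {E : Set P // LS.IsPlane E} := ⟨_, isPlane_span_insert hm hC⟩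
  obtain ⟨E, hE⟩ := exists_encard_sdiff_singleton_le (hX.trans_eq (by rfl : (3 : ℕ∞) = 2 + 1))
  obtain ⟨F, hF⟩ := exists_encard_sdiff_singleton_le (hE.trans_eq (by rfl : (2 : ℕ∞) = 1 + 1))
  obtain ⟨G, hG'⟩ := exists_encard_sdiff_singleton_le (hF.trans_eq (zero_add 1).symm)
  obtain ⟨Q, hQE, hQF, hQG⟩ := hG.exists_mem_three_planes hdim E.2 F.2 G.2
  refine ⟨Q, fun H hH => ?_⟩
  by_contra hQ
  refine (Set.encard_eq_zero.1 (nonpos_iff_eq_zero.1 hG')).subset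
    (⟨⟨⟨hH, ?_⟩, ?_⟩, ?_⟩ : H ∈ ((X \ {E}) \ {F}) \ {G}) <;> rintro rfl
  exacts [hQ hQE, hQ hQF, hQ hQG]

lemma isGenProjSpace_dual (hdim : LS.dim = 3) (hG : LS.IsGenProjSpace) :
    (LS.dual hdim hG).IsGenProjSpace := by
  rintro S ⟨-, hS⟩ _ ⟨a, ha, rfl⟩ _ ⟨b, hb, rfl⟩ haS hbS hab
  obtain ⟨X, rfl, hc⟩ := exists_span_eq_of_sdim_eq (n := 2) hS
  obtain ⟨Q, hQ⟩ := exists_forall_mem_of_encard_le_three hdim hG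
    ((tsub_le_iff_right.1 hc.le).trans_eq rfl : X.encard ≤ 3)
  have hstar := span_subset (isSubspace_dual_star hdim hG Q) hQ
  obtain ⟨E, hE, haE, hbE⟩ := exists_plane_of_meet ha hb (fun h => hab (h ▸ rfl))
    (mem_axis_of_forall_mem hdim hG ha fun E hE => hstar (haS hE))
    (mem_axis_of_forall_mem hdim hG hb fun E hE => hstar (hbS hE))
  exact ⟨⟨E, hE⟩, haE, hbE⟩

/-- A plane lies in a dual subspace as soon as its lines in a plane `E₀` of the subspace
are joined to some point off `E₀` by planes of the subspace. -/
lemma mem_of_forall_join_mem (hdim : LS.dim = 3) (hG : LS.IsGenProjSpace)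
    {S : Set {E : Set P // LS.IsPlane E}}
    (hS : (LS.dual hdim hG).IsSubspace S) {E₀ F : {E : Set P // LS.IsPlane E}} (hE₀ : E₀ ∈ S)
    {D : P} (hD : D ∉ E₀.1)
    (h : ∀ l ∈ LS.lines, l ⊆ E₀.1 → l ⊆ F.1 → ∀ G : {E : Set P // LS.IsPlane E},
      l ⊆ G.1 → D ∈ G.1 → G ∈ S) : F ∈ S := by
  obtain ⟨l, hl, hlE, hlF⟩ := hG.exists_line_inter hdim E₀.2 F.2
  have hDl : D ∉ l := fun h => hD (hlE h)
  let G : {E : Set P // LS.IsPlane E} := ⟨_, isPlane_span_insert hl hDl⟩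
  have hlG : l ⊆ G.1 := subset_span_insert D l
  have hDG : D ∈ G.1 := mem_span_insert D l
  exact hS _ (dualPencil_mem_lines hdim hG hl) E₀ hlE G hlG (fun h => hD (h ▸ hDG)) hE₀
    (h l hl hlE hlF G hlG hDG) hlF

lemma dim_dual (hdim : LS.dim = 3) (hG : LS.IsGenProjSpace) :
    (LS.dual hdim hG).dim = 3 := by
  apply le_antisymm
  · obtain ⟨l, hl, C, D, hC, hD, -⟩ := exists_tetrahedron hdim
    obtain ⟨A, B, hAB, hA, hB⟩ := LS.two_points l hl
    have hCA : C ≠ A := fun h => hC (h ▸ hA)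
    have hCB : C ≠ B := fun h => hC (h ▸ hB)
    obtain ⟨p, hp, hCp, hBp⟩ := exists_line (LS := LS) hCB
    obtain ⟨q, hq, hCq, hAq⟩ := exists_line (LS := LS) hCA
    have hAp : A ∉ p := fun h => hC (line_eq hAB hp hl h hBp hA hB ▸ hCp)
    have hABC := isPlane_span_insert hl hC
    have hlE := subset_span_insert (LS := LS) C l
    have hCE := mem_span_insert (LS := LS) C l
    have hpE := hABC.1 p hp C hCp B hBp hCB hCE (hlE hB)
    have hqE := hABC.1 q hq C hCq A hAq hCA hCE (hlE hA)
    generalize LS.span (insert C l) = E₀ at hABC hlE hCE hpE hqE hD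
    have hDAB := isPlane_span_insert hl fun h => hD (hlE h)
    have hDBC := isPlane_span_insert hp fun h => hD (hpE h)
    have hDCA := isPlane_span_insert hq fun h => hD (hqE h)
    let E₁ : {E : Set P // LS.IsPlane E} := ⟨_, hDBC⟩
    let E₂ : {E : Set P // LS.IsPlane E} := ⟨_, hDCA⟩
    let E₃ : {E : Set P // LS.IsPlane E} := ⟨_, hDAB⟩
    let X : Set {E : Set P // LS.IsPlane E} := {⟨E₀, hABC⟩, E₁, E₂, E₃}
    have hS := isSubspace_span (LS := LS.dual hdim hG) X
    have hXS := subset_span (LS := LS.dual hdim hG) X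
    have hA₁ : A ∉ E₁.1 := fun h => hD <| hG.plane_eq hDBC hABC hp (subset_span_insert D p) hpE h
      (hlE hA) hAp ▸ mem_span_insert D p
    have h₂₃ : E₂ ≠ E₃ := fun h => by
      have hC₃ : C ∈ E₃.1 := h ▸ subset_span_insert D q hCq
      exact hD (hG.plane_eq hDAB hABC hl (subset_span_insert D l) hlE hC₃ hCE hC ▸
        mem_span_insert D l)
    have hDA : D ≠ A := fun h => hD (h ▸ hlE hA)
    obtain ⟨r, hr, hDr, hAr⟩ := exists_line (LS := LS) hDA
    have hr_sub : ∀ G : {E : Set P // LS.IsPlane E}, D ∈ G.1 → A ∈ G.1 → r ⊆ G.1 :=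
      fun G => G.2.1 r hr D hDr A hAr hDA
    have hspan : (LS.dual hdim hG).span X = Set.univ := by
      refine Set.eq_univ_of_forall fun F => ?_
      refine mem_of_forall_join_mem hdim hG hS (hXS (Or.inl rfl)) hD ?_
      intro _ _ _ _ G _ hDG
      by_cases hG₁ : G = E₁
      · exact hG₁ ▸ hXS (by simp [X])
      refine mem_of_forall_join_mem hdim hG hS (E₀ := E₁) (hXS (by simp [X])) hA₁ ?_
      intro b hb hb₁ hbG H hbH hAH
      have hDb : D ∈ b := hG.mem_of_mem_inter E₁.2 G.2 (fun h => hG₁ (Subtype.ext h.symm)) hb hb₁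
        hbG (mem_span_insert D p) hDG
      exact hS _ (dualPencil_mem_lines hdim hG hr)
        E₂ (hr_sub E₂ (mem_span_insert D q) (subset_span_insert D q hAq))
        E₃ (hr_sub E₃ (mem_span_insert D l) (subset_span_insert D l hA))
        h₂₃ (hXS (by simp [X])) (hXS (by simp [X])) (hr_sub H (hbH hDb) hAH)
    refine (sdim_le hspan).trans (tsub_le_iff_right.2 ?_)
    calc X.encard ≤ 1 + 1 + 1 + 1 :=
          (Set.encard_insert_le _ _).trans <| add_le_add_left ((Set.encard_insert_le _ _).trans <|
            add_le_add_left ((Set.encard_insert_le _ _).trans_eq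
              (by rw [Set.encard_singleton])) 1) 1
      _ = 3 + 1 := rfl
  · refine le_sInf ?_
    rintro d ⟨X, -, hX, rfl⟩
    by_contra! hlt
    have hX3 : X.encard ≤ 3 := by
      have h := Order.le_of_lt_add_one (x := X.encard - 1) (y := 2) hlt
      exact (tsub_le_iff_right.1 h).trans_eq rfl
    obtain ⟨Q, hQ⟩ := exists_forall_mem_of_encard_le_three hdim hG hX3
    obtain ⟨E, hE, hQE⟩ := hG.exists_plane_notMem hdim Q
    have hstar := span_subset (isSubspace_dual_star hdim hG Q) hQ
    rw [hX] at hstar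
    exact hQE (hstar (Set.mem_univ ⟨E, hE⟩))

end Dual

end LinearSpace

/-- The dual of a 3-dimensional generalized projective space, whose points are
the planes and whose lines are the pencils of planes, is a linear space and is
itself a 3-dimensional generalized projective space. -/
theorem dual_is_genProjSpace
    {P : Type*} (LS : LinearSpace P) (hdim : LS.dim = 3)
    (hGPS : LS.IsGenProjSpace) :
    ∃ D : LinearSpace {E : Set P // LS.IsPlane E},
      D.lines = {S | ∃ a ∈ LS.lines,
        S = {E : {E : Set P // LS.IsPlane E} | a ⊆ E.1}} ∧
      D.dim = 3 ∧ D.IsGenProjSpace := by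
  exact ⟨LS.dual hdim hGPS, rfl, LinearSpace.dim_dual hdim hGPS,
    LinearSpace.isGenProjSpace_dual hdim hGPS⟩
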